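/- Fix nonnegative integers m, n and a positive integer r, and for a nonnegative integer p define the polynomial B_p(γ) := ∑_{i=0}^{2r} [ (−2r)_i · (−p−n−2r)_i / ( (1/2 − n − 2r)_i · i! ) ] · γ^i. If γ* ∈ (0, 1) satisfies B_{m+1}'(γ*) = 0 (derivative in γ), then B_{m+1}(γ*) = B_m(γ*). -/

import Mathlib

/-- The rising factorial `(α)_k = α (α+1) ⋯ (α+k-1)`, with `(α)_0 = 1`. -/
def risingFactorial (α : ℝ) (k : ℕ) : ℝ := ∏ j ∈ Finset.range k, (α + j)

/-- The terminating hypergeometric polynomial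
`B_p(γ) = F(-2r, -p-n-2r, 1/2-n-2r; γ)
        = ∑_{i=0}^{2r} (-2r)_i (-p-n-2r)_i / ((1/2-n-2r)_i i!) γ^i`. -/
noncomputable def Bpoly (n r p : ℕ) (γ : ℝ) : ℝ :=
  ∑ i ∈ Finset.range (2 * r + 1),
    risingFactorial (-(2 * (r : ℝ))) i *
      risingFactorial (-((p : ℝ) + (n : ℝ) + 2 * (r : ℝ))) i /
      (risingFactorial (1 / 2 - (n : ℝ) - 2 * (r : ℝ)) i * (Nat.factorial i : ℝ)) *
      γ ^ i

theorem mul_risingFactorial_add_one (α : ℝ) (k : ℕ) :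
    α * risingFactorial (α + 1) k = (α + k) * risingFactorial α k := by
  unfold risingFactorial
  rw [mul_comm (α + k), ← Finset.prod_range_succ (fun j : ℕ => α + (j : ℝ)),
    Finset.prod_range_succ', mul_comm]
  simp only [Nat.cast_add, Nat.cast_one, Nat.cast_zero, add_zero]
  congr 1
  exact Finset.prod_congr rfl fun j _ => by ring

theorem hasDerivAt_Bpoly (n r p : ℕ) (γ : ℝ) :
    HasDerivAt (Bpoly n r p)
      (∑ i ∈ Finset.range (2 * r + 1),
        risingFactorial (-(2 * (r : ℝ))) i *
          risingFactorial (-((p : ℝ) + (n : ℝ) + 2 * (r : ℝ))) i /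
          (risingFactorial (1 / 2 - (n : ℝ) - 2 * (r : ℝ)) i * (Nat.factorial i : ℝ)) *
          ((i : ℝ) * γ ^ (i - 1))) γ :=
  HasDerivAt.fun_sum fun i _ => (hasDerivAt_pow i γ).const_mul _

/-- The contiguous relation `b F(b + 1) = (b + γ d/dγ) F(b)` for the second parameter. -/
theorem mul_deriv_Bpoly_succ (n r p : ℕ) (γ : ℝ) :
    γ * deriv (Bpoly n r (p + 1)) γ =
      ((p : ℝ) + 1 + n + 2 * r) * (Bpoly n r (p + 1) γ - Bpoly n r p γ) := by
  rw [(hasDerivAt_Bpoly n r (p + 1) γ).deriv]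
  unfold Bpoly
  rw [← Finset.sum_sub_distrib, Finset.mul_sum, Finset.mul_sum]
  refine Finset.sum_congr rfl fun i _ => ?_
  have h := mul_risingFactorial_add_one (-(((p + 1 : ℕ) : ℝ) + (n : ℝ) + 2 * (r : ℝ))) i
  rw [show -(((p + 1 : ℕ) : ℝ) + (n : ℝ) + 2 * (r : ℝ)) + 1 = -((p : ℝ) + n + 2 * r) by
    push_cast; ring] at h
  have hpow : γ * ((i : ℝ) * γ ^ (i - 1)) = i * γ ^ i := by
    cases i with
    | zero => simp
    | succ k => rw [Nat.add_sub_cancel, pow_succ]; ring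
  rw [mul_left_comm, hpow]
  generalize risingFactorial (-(((p + 1 : ℕ) : ℝ) + (n : ℝ) + 2 * (r : ℝ))) i = x at h ⊢
  push_cast at h
  linear_combination
    -(risingFactorial (-(2 * (r : ℝ))) i /
      (risingFactorial (1 / 2 - (n : ℝ) - 2 * (r : ℝ)) i * (Nat.factorial i : ℝ)) * γ ^ i) * h

/-- If `γ* ∈ (0, 1)` is a critical point of `B_{m+1}`, then
`B_{m+1}(γ*) = B_m(γ*)`. -/
theorem Bpoly_critical_point_eq (m n r : ℕ) (hr : 0 < r)
    (γstar : ℝ) (h0 : 0 < γstar) (h1 : γstar < 1)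
    (hcrit : deriv (Bpoly n r (m + 1)) γstar = 0) :
    Bpoly n r (m + 1) γstar = Bpoly n r m γstar := by
  have h := mul_deriv_Bpoly_succ n r m γstar
  rw [hcrit, mul_zero] at h
  have hpos : (m : ℝ) + 1 + n + 2 * r ≠ 0 := by positivity
  exact sub_eq_zero.mp ((mul_eq_zero.mp h.symm).resolve_left hpos)
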